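/- arXiv:1901.00214 — 2 statements merged into one kernel-verified Lean document; each statement's English description precedes it below -/
import Mathlib

section
/- For each ρ > 0, every global minimizer of J^ρ(·,·) is a generalized Lloyd's minimum of J^ρ, i.e. J^ρ_g ⊆ J^ρ, and consequently every global minimizer of Q^ρ(·) belongs to M^ρ, i.e. M^ρ_g ⊆ M^ρ. -/
open scoped BigOperators

noncomputable section

/-! ### Basic (centralized) K-means notions -/

/-- The dataset `D` contains at least `K` distinct points. -/
def HasKDistinct {p : ℕ} (K : ℕ) (D : Multiset (EuclideanSpace ℝ (Fin p))) : Prop :=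
  ∃ S : Finset (EuclideanSpace ℝ (Fin p)), S.card = K ∧ ∀ y ∈ S, y ∈ D

/-- The K-means clustering cost `F(x) = ∑_{y ∈ D} min_k ‖y - x^k‖²`. -/
def kmeansF {p : ℕ} (K : ℕ) (D : Multiset (EuclideanSpace ℝ (Fin p)))
    (x : Fin K → EuclideanSpace ℝ (Fin p)) : ℝ :=
  (D.map fun y => ⨅ k : Fin K, ‖y - x k‖ ^ 2).sum

/-- `P` is a partition of the multiset `D` into `K` (possibly empty) cells. -/
def IsKPartition {p K : ℕ} (D : Multiset (EuclideanSpace ℝ (Fin p)))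
    (P : Fin K → Multiset (EuclideanSpace ℝ (Fin p))) : Prop :=
  ∑ k, P k = D

/-- The distortion cost `H(x, P) = ∑_k ∑_{y ∈ P^k} ‖y - x^k‖²`. -/
def costH {p K : ℕ} (x : Fin K → EuclideanSpace ℝ (Fin p))
    (P : Fin K → Multiset (EuclideanSpace ℝ (Fin p))) : ℝ :=
  ∑ k, ((P k).map fun y => ‖y - x k‖ ^ 2).sum

/-- `(x, P)` is a Lloyd's minimum for the dataset `D`. -/
def IsLloydMin {p K : ℕ} (D : Multiset (EuclideanSpace ℝ (Fin p)))
    (x : Fin K → EuclideanSpace ℝ (Fin p))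
    (P : Fin K → Multiset (EuclideanSpace ℝ (Fin p))) : Prop :=
  IsKPartition D P ∧
    (∀ Q, IsKPartition D Q → costH x P ≤ costH x Q) ∧
    (∀ x', costH x P ≤ costH x' P)

/-- The set `Z` of Lloyd's minima (cluster-center tuples). -/
def LloydZ {p : ℕ} (K : ℕ) (D : Multiset (EuclideanSpace ℝ (Fin p))) :
    Set (Fin K → EuclideanSpace ℝ (Fin p)) :=
  {x | ∃ P, IsLloydMin D x P}

/-- The set `Z̄` of Lloyd's minima whose centers lie in the (closed) convex hull of `D`. -/
def LloydZbar {p : ℕ} (K : ℕ) (D : Multiset (EuclideanSpace ℝ (Fin p))) :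
    Set (Fin K → EuclideanSpace ℝ (Fin p)) :=
  {x ∈ LloydZ K D | ∀ k, x k ∈ convexHull ℝ {y | y ∈ D}}

/-- The set `Z_g` of global minimizers of the K-means cost `F`. -/
def kmeansZg {p : ℕ} (K : ℕ) (D : Multiset (EuclideanSpace ℝ (Fin p))) :
    Set (Fin K → EuclideanSpace ℝ (Fin p)) :=
  {x | ∀ x', kmeansF K D x ≤ kmeansF K D x'}

/-- The global minimum value `F*` of the K-means cost. -/
def Fstar {p : ℕ} (K : ℕ) (D : Multiset (EuclideanSpace ℝ (Fin p))) : ℝ :=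
  sInf (Set.range (kmeansF K D))

/-- `R₀ = max{‖v‖ : v ∈ closed convex hull of D}`. -/
def R0 {p : ℕ} (D : Multiset (EuclideanSpace ℝ (Fin p))) : ℝ :=
  sSup ((fun v => ‖v‖) '' convexHull ℝ {y | y ∈ D})

/-! ### Multi-agent notions -/

section Distributed

variable {p K M : ℕ}

/-- The multi-agent cost `J^ρ(x, C)`; each undirected edge is counted once in the
agreement term. -/
def costJ (ρ : ℝ) (G : SimpleGraph (Fin M)) [DecidableRel G.Adj]
    (x : Fin M → Fin K → EuclideanSpace ℝ (Fin p))
    (C : Fin M → Fin K → Multiset (EuclideanSpace ℝ (Fin p))) : ℝ :=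
  (1 / ρ) * ∑ m, ∑ k, ((C m k).map fun y => ‖y - x m k‖ ^ 2).sum +
    (1 / 2) * ∑ m, ∑ l ∈ G.neighborFinset m, ∑ k, ‖x m k - x l k‖ ^ 2

/-- The multi-agent cost `Q^ρ(x)`. -/
def costQ (ρ : ℝ) (G : SimpleGraph (Fin M)) [DecidableRel G.Adj]
    (Dm : Fin M → Multiset (EuclideanSpace ℝ (Fin p)))
    (x : Fin M → Fin K → EuclideanSpace ℝ (Fin p)) : ℝ :=
  (1 / ρ) * ∑ m, ((Dm m).map fun y => ⨅ k : Fin K, ‖y - x m k‖ ^ 2).sum +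
    (1 / 2) * ∑ m, ∑ l ∈ G.neighborFinset m, ∑ k, ‖x m k - x l k‖ ^ 2

/-- The set of global minimizers `M^ρ_g` of `Q^ρ`. -/
def globQ (ρ : ℝ) (G : SimpleGraph (Fin M)) [DecidableRel G.Adj]
    (Dm : Fin M → Multiset (EuclideanSpace ℝ (Fin p))) (K : ℕ) :
    Set (Fin M → Fin K → EuclideanSpace ℝ (Fin p)) :=
  {x | ∀ x' : Fin M → Fin K → EuclideanSpace ℝ (Fin p), costQ ρ G Dm x ≤ costQ ρ G Dm x'}

/-- `C ∈ U_x` : `C` is an admissible (Voronoi / nearest-center) clustering for `x`. -/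
def InVoronoi (Dm : Fin M → Multiset (EuclideanSpace ℝ (Fin p)))
    (x : Fin M → Fin K → EuclideanSpace ℝ (Fin p))
    (C : Fin M → Fin K → Multiset (EuclideanSpace ℝ (Fin p))) : Prop :=
  (∀ m, IsKPartition (Dm m) (C m)) ∧
    ∀ m k y, y ∈ C m k → ∀ k', ‖y - x m k‖ ≤ ‖y - x m k'‖

/-- The fixed-point (stationarity) equations
`((1/ρ)|C_m^k| + |Ω_m|) x_m^k = (1/ρ) ∑_{y ∈ C_m^k} y + ∑_{l ∈ Ω_m} x_l^k`. -/
def IsFixedCenters (ρ : ℝ) (G : SimpleGraph (Fin M)) [DecidableRel G.Adj]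
    (x : Fin M → Fin K → EuclideanSpace ℝ (Fin p))
    (C : Fin M → Fin K → Multiset (EuclideanSpace ℝ (Fin p))) : Prop :=
  ∀ m k, ((1 / ρ) * ((C m k).card : ℝ) + (G.degree m : ℝ)) • x m k =
      (1 / ρ) • (C m k).sum + ∑ l ∈ G.neighborFinset m, x l k

/-- `(x, C)` is a generalized Lloyd's minimum of `J^ρ`. -/
def IsGenLloydMin (ρ : ℝ) (G : SimpleGraph (Fin M)) [DecidableRel G.Adj]
    (Dm : Fin M → Multiset (EuclideanSpace ℝ (Fin p)))
    (x : Fin M → Fin K → EuclideanSpace ℝ (Fin p))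
    (C : Fin M → Fin K → Multiset (EuclideanSpace ℝ (Fin p))) : Prop :=
  InVoronoi Dm x C ∧ IsFixedCenters ρ G x C

/-- The set `M^ρ` of generalized Lloyd's minima (centers part). -/
def genM (ρ : ℝ) (G : SimpleGraph (Fin M)) [DecidableRel G.Adj]
    (Dm : Fin M → Multiset (EuclideanSpace ℝ (Fin p))) (K : ℕ) :
    Set (Fin M → Fin K → EuclideanSpace ℝ (Fin p)) :=
  {x | ∃ C, IsGenLloydMin ρ G Dm x C}

/-- The set `M̄^ρ` of generalized Lloyd's minima with all centers in the (closed)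
convex hull of the collective dataset `D`. -/
def genMbar (ρ : ℝ) (G : SimpleGraph (Fin M)) [DecidableRel G.Adj]
    (Dm : Fin M → Multiset (EuclideanSpace ℝ (Fin p)))
    (D : Multiset (EuclideanSpace ℝ (Fin p))) (K : ℕ) :
    Set (Fin M → Fin K → EuclideanSpace ℝ (Fin p)) :=
  {x ∈ genM ρ G Dm K | ∀ m k, x m k ∈ convexHull ℝ {y | y ∈ D}}

/-- The update target
`μ_m^k = ((1/ρ) ∑_{y ∈ C_m^k} y + ∑_{l ∈ Ω_m} x_l^k) / ((1/ρ)|C_m^k| + |Ω_m|)`. -/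
def muVec (ρ : ℝ) (G : SimpleGraph (Fin M)) [DecidableRel G.Adj]
    (x : Fin M → Fin K → EuclideanSpace ℝ (Fin p))
    (C : Fin M → Fin K → Multiset (EuclideanSpace ℝ (Fin p)))
    (m : Fin M) (k : Fin K) : EuclideanSpace ℝ (Fin p) :=
  ((1 / ρ) * ((C m k).card : ℝ) + (G.degree m : ℝ))⁻¹ •
    ((1 / ρ) • (C m k).sum + ∑ l ∈ G.neighborFinset m, x l k)

/-- `(x_t, C_t)` is a trajectory of the NK-means algorithm with parameters `ρ, α`. -/
def NKMeansSeq (ρ α : ℝ) (G : SimpleGraph (Fin M)) [DecidableRel G.Adj]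
    (Dm : Fin M → Multiset (EuclideanSpace ℝ (Fin p)))
    (x : ℕ → Fin M → Fin K → EuclideanSpace ℝ (Fin p))
    (C : ℕ → Fin M → Fin K → Multiset (EuclideanSpace ℝ (Fin p))) : Prop :=
  (∀ m, IsKPartition (Dm m) (C 0 m)) ∧
    ∀ t, (∀ m, IsKPartition (Dm m) (C (t + 1) m)) ∧
      (∀ m k y, y ∈ C (t + 1) m k → ∀ k', ‖y - x t m k‖ ≤ ‖y - x t m k'‖) ∧
      ∀ m k, x (t + 1) m k = x t m k - α • (x t m k - muVec ρ G (x t) (C (t + 1)) m k)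

/-- The minimum vertex degree `d_min` of the communication graph. -/
def minDeg (G : SimpleGraph (Fin M)) [DecidableRel G.Adj] : ℕ :=
  sInf (Set.range fun m : Fin M => G.degree m)

/-- The largest eigenvalue `λ_M(L)` of the graph Laplacian. -/
def lapLamMax (G : SimpleGraph (Fin M)) [DecidableRel G.Adj] : ℝ :=
  sSup (spectrum ℝ (G.lapMatrix ℝ))

/-- The second-smallest eigenvalue `λ₂(L)` of the graph Laplacian (for a connected
graph, the smallest nonzero eigenvalue). -/
def lapLam2 (G : SimpleGraph (Fin M)) [DecidableRel G.Adj] : ℝ :=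
  sInf {μ : ℝ | μ ∈ spectrum ℝ (G.lapMatrix ℝ) ∧ μ ≠ 0}

/-- `N* = max_m |D_m|`. -/
def Nstar (Dm : Fin M → Multiset (EuclideanSpace ℝ (Fin p))) : ℕ :=
  Finset.univ.sup fun m => (Dm m).card

/-- The step-size condition `0 < α < d_min / ((1/ρ) N* + λ_M(L))`. -/
def StepOK (ρ α : ℝ) (G : SimpleGraph (Fin M)) [DecidableRel G.Adj]
    (Dm : Fin M → Multiset (EuclideanSpace ℝ (Fin p))) : Prop :=
  0 < α ∧ α * ((1 / ρ) * (Nstar Dm : ℝ) + lapLamMax G) < (minDeg G : ℝ)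

/-- The constant `c(α) = 2α(d_min − α((1/ρ)N* + λ_M(L)))`. -/
def cAlpha (ρ α : ℝ) (G : SimpleGraph (Fin M)) [DecidableRel G.Adj]
    (Dm : Fin M → Multiset (EuclideanSpace ℝ (Fin p))) : ℝ :=
  2 * α * ((minDeg G : ℝ) - α * ((1 / ρ) * (Nstar Dm : ℝ) + lapLamMax G))

end Distributed
open scoped RealInnerProductSpace

section Helpers

variable {p K M : ℕ}

theorem iInf_sqDist_le (y : EuclideanSpace ℝ (Fin p)) (x : Fin K → EuclideanSpace ℝ (Fin p))
    (k : Fin K) : ⨅ j, ‖y - x j‖ ^ 2 ≤ ‖y - x k‖ ^ 2 :=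
  ciInf_le (Set.finite_range _).bddBelow k

theorem kmeansF_eq_sum {D : Multiset (EuclideanSpace ℝ (Fin p))}
    {P : Fin K → Multiset (EuclideanSpace ℝ (Fin p))} (hP : IsKPartition D P)
    (x : Fin K → EuclideanSpace ℝ (Fin p)) :
    kmeansF K D x = ∑ k, ((P k).map fun y => ⨅ j, ‖y - x j‖ ^ 2).sum := by
  unfold IsKPartition at hP
  subst hP
  unfold kmeansF
  rw [← Multiset.coe_mapAddMonoidHom, map_sum, ← Multiset.coe_sumAddMonoidHom, map_sum]

theorem kmeansF_le_costH {D : Multiset (EuclideanSpace ℝ (Fin p))}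
    {P : Fin K → Multiset (EuclideanSpace ℝ (Fin p))} (hP : IsKPartition D P)
    (x : Fin K → EuclideanSpace ℝ (Fin p)) : kmeansF K D x ≤ costH x P := by
  rw [kmeansF_eq_sum hP]
  exact Finset.sum_le_sum fun k _ => Multiset.sum_map_le_sum_map _ _ fun y _ => iInf_sqDist_le y x k

theorem norm_sub_le_of_costH_le {D : Multiset (EuclideanSpace ℝ (Fin p))}
    {P : Fin K → Multiset (EuclideanSpace ℝ (Fin p))} (hP : IsKPartition D P)
    {x : Fin K → EuclideanSpace ℝ (Fin p)} (h : costH x P ≤ kmeansF K D x)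
    {k : Fin K} {y : EuclideanSpace ℝ (Fin p)} (hy : y ∈ P k) (k' : Fin K) :
    ‖y - x k‖ ≤ ‖y - x k'‖ := by
  by_contra! hlt
  refine h.not_gt ?_
  rw [kmeansF_eq_sum hP]
  refine Finset.sum_lt_sum (fun j _ => Multiset.sum_map_le_sum_map _ _ fun z _ =>
    iInf_sqDist_le z x j) ⟨k, Finset.mem_univ k, ?_⟩
  obtain ⟨s, hs⟩ := Multiset.exists_cons_of_mem hy
  rw [hs, Multiset.map_cons, Multiset.map_cons, Multiset.sum_cons, Multiset.sum_cons]
  refine add_lt_add_of_lt_of_le ?_ (Multiset.sum_map_le_sum_map _ _ fun z _ => iInf_sqDist_le z x k)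
  exact (iInf_sqDist_le y x k').trans_lt (by gcongr)

theorem exists_costH_eq_kmeansF [NeZero K] (D : Multiset (EuclideanSpace ℝ (Fin p)))
    (x : Fin K → EuclideanSpace ℝ (Fin p)) :
    ∃ P, IsKPartition D P ∧ costH x P = kmeansF K D x := by
  classical
  have hmin (y : EuclideanSpace ℝ (Fin p)) : ∃ k, ‖y - x k‖ ^ 2 = ⨅ j, ‖y - x j‖ ^ 2 :=
    exists_eq_ciInf_of_finite
  choose κ hκ using hmin
  have hP : IsKPartition D fun k => D.filter fun y => κ y = k := by
    unfold IsKPartition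
    ext y
    simp [Multiset.count_sum', Multiset.count_filter]
  refine ⟨_, hP, ?_⟩
  rw [kmeansF_eq_sum hP]
  refine Finset.sum_congr rfl fun k _ => congrArg _ (Multiset.map_congr rfl fun y hy => ?_)
  rw [← hκ y, (Multiset.mem_filter.1 hy).2]

/-- Summing over ordered pairs of neighbours is symmetric in the pair. -/
theorem sum_neighborFinset_comm (G : SimpleGraph (Fin M)) [DecidableRel G.Adj]
    (f : Fin M → Fin M → ℝ) :
    ∑ m, ∑ l ∈ G.neighborFinset m, f m l = ∑ m, ∑ l ∈ G.neighborFinset m, f l m := by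
  refine Finset.sum_comm' fun m l => ?_
  simp [G.adj_comm]

/-- Half the gradient of `costJ` with respect to the center `x m k`. -/
def centerGrad (ρ : ℝ) (G : SimpleGraph (Fin M)) [DecidableRel G.Adj]
    (x : Fin M → Fin K → EuclideanSpace ℝ (Fin p))
    (C : Fin M → Fin K → Multiset (EuclideanSpace ℝ (Fin p))) (m : Fin M) (k : Fin K) :
    EuclideanSpace ℝ (Fin p) :=
  ((1 / ρ) * ((C m k).card : ℝ) + (G.degree m : ℝ)) • x m k -
    ((1 / ρ) • (C m k).sum + ∑ l ∈ G.neighborFinset m, x l k)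

theorem sum_sqDist_add_smul (S : Multiset (EuclideanSpace ℝ (Fin p)))
    (a w : EuclideanSpace ℝ (Fin p)) (t : ℝ) :
    (S.map fun y => ‖y - (a + t • w)‖ ^ 2).sum =
      (S.map fun y => ‖y - a‖ ^ 2).sum + 2 * t * ⟪(S.card : ℝ) • a - S.sum, w⟫ +
        t ^ 2 * (S.card * ‖w‖ ^ 2) := by
  induction S using Multiset.induction_on with
  | empty => simp
  | cons y S ih =>
    have h : ‖y - (a + t • w)‖ ^ 2 = ‖y - a‖ ^ 2 + 2 * t * ⟪a - y, w⟫ + t ^ 2 * ‖w‖ ^ 2 := by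
      rw [← sub_sub, norm_sub_sq_real, real_inner_smul_right, norm_smul, mul_pow, Real.norm_eq_abs,
        sq_abs, ← neg_sub a y, inner_neg_left, norm_neg]
      ring
    simp only [Multiset.map_cons, Multiset.sum_cons, Multiset.card_cons, ih, h]
    push_cast
    simp only [inner_sub_left, inner_add_left, add_smul, one_smul]
    ring

/-- Second order expansion of `costJ` along a direction `w`. -/
theorem costJ_add_smul (ρ : ℝ) (G : SimpleGraph (Fin M)) [DecidableRel G.Adj]
    (x w : Fin M → Fin K → EuclideanSpace ℝ (Fin p))
    (C : Fin M → Fin K → Multiset (EuclideanSpace ℝ (Fin p))) (t : ℝ) :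
    costJ ρ G (x + t • w) C =
      costJ ρ G x C + 2 * t * ∑ m, ∑ k, ⟪centerGrad ρ G x C m k, w m k⟫ +
        t ^ 2 * ((1 / ρ) * ∑ m, ∑ k, ((C m k).card : ℝ) * ‖w m k‖ ^ 2 +
          (1 / 2) * ∑ m, ∑ l ∈ G.neighborFinset m, ∑ k, ‖w m k - w l k‖ ^ 2) := by
  have hedge (a b u v : EuclideanSpace ℝ (Fin p)) : ‖a + t • u - (b + t • v)‖ ^ 2 =
      ‖a - b‖ ^ 2 + (2 * t * ⟪a - b, u⟫ + 2 * t * ⟪b - a, v⟫) + t ^ 2 * ‖u - v‖ ^ 2 := by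
    rw [add_sub_add_comm, ← smul_sub, norm_add_sq_real, real_inner_smul_right, norm_smul, mul_pow,
      Real.norm_eq_abs, sq_abs, inner_sub_right, ← neg_sub a b, inner_neg_left]
    ring
  have hsymm : ∑ m, ∑ l ∈ G.neighborFinset m, ∑ k, ⟪x l k - x m k, w l k⟫ =
      ∑ m, ∑ l ∈ G.neighborFinset m, ∑ k, ⟪x m k - x l k, w m k⟫ :=
    sum_neighborFinset_comm G fun m l => ∑ k, ⟪x l k - x m k, w l k⟫
  have hgrad : ∑ m, ∑ k, ⟪centerGrad ρ G x C m k, w m k⟫ =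
      (1 / ρ) * ∑ m, ∑ k, ⟪((C m k).card : ℝ) • x m k - (C m k).sum, w m k⟫ +
        ∑ m, ∑ l ∈ G.neighborFinset m, ∑ k, ⟪x m k - x l k, w m k⟫ := by
    rw [Finset.mul_sum, ← Finset.sum_add_distrib]
    refine Finset.sum_congr rfl fun m _ => ?_
    rw [Finset.mul_sum, Finset.sum_comm, ← Finset.sum_add_distrib]
    refine Finset.sum_congr rfl fun k _ => ?_
    rw [← real_inner_smul_left, ← sum_inner, ← inner_add_left]
    congr 1
    rw [Finset.sum_sub_distrib, Finset.sum_const, G.card_neighborFinset_eq_degree, centerGrad,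
      ← Nat.cast_smul_eq_nsmul ℝ]
    module
  simp only [costJ, Pi.add_apply, Pi.smul_apply, sum_sqDist_add_smul, hedge,
    Finset.sum_add_distrib, ← Finset.mul_sum]
  rw [hgrad, hsymm]
  ring

theorem eq_zero_of_forall_linear_add_quadratic_nonneg {a b : ℝ}
    (h : ∀ t : ℝ, 0 ≤ t * a + t ^ 2 * b) : a = 0 := by
  have hb : 0 < |b| + 1 := by positivity
  have h1 := h (-a / (|b| + 1))
  have h2 : -a / (|b| + 1) * a + (-a / (|b| + 1)) ^ 2 * b =
      -(a ^ 2 * (|b| + 1 - b)) / (|b| + 1) ^ 2 := by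
    field_simp
    ring
  rw [h2, le_div_iff₀ (by positivity)] at h1
  nlinarith [sq_nonneg a, le_abs_self b]

theorem isFixedCenters_of_forall_costJ_le {ρ : ℝ} {G : SimpleGraph (Fin M)} [DecidableRel G.Adj]
    {x : Fin M → Fin K → EuclideanSpace ℝ (Fin p)}
    {C : Fin M → Fin K → Multiset (EuclideanSpace ℝ (Fin p))}
    (h : ∀ x', costJ ρ G x C ≤ costJ ρ G x' C) : IsFixedCenters ρ G x C := by
  intro m k
  have hzero := eq_zero_of_forall_linear_add_quadratic_nonneg (a := 2 * ∑ m, ∑ k,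
      ⟪centerGrad ρ G x C m k, centerGrad ρ G x C m k⟫) fun t => by
    have ht := h (x + t • centerGrad ρ G x C)
    rw [costJ_add_smul, add_assoc] at ht
    rw [← mul_assoc, mul_comm t 2]
    exact le_of_add_le_add_left ((add_zero _).trans_le ht)
  have hsum := (mul_eq_zero.1 hzero).resolve_left two_ne_zero
  rw [Finset.sum_eq_zero_iff_of_nonneg fun i _ =>
    Finset.sum_nonneg fun j _ => real_inner_self_nonneg] at hsum
  have hm := hsum m (Finset.mem_univ m)
  rw [Finset.sum_eq_zero_iff_of_nonneg fun j _ => real_inner_self_nonneg] at hm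
  exact sub_eq_zero.1 (inner_self_eq_zero.1 (hm k (Finset.mem_univ k)))

theorem costQ_le_costJ {ρ : ℝ} (hρ : 0 < ρ) (G : SimpleGraph (Fin M)) [DecidableRel G.Adj]
    {Dm : Fin M → Multiset (EuclideanSpace ℝ (Fin p))}
    (x : Fin M → Fin K → EuclideanSpace ℝ (Fin p))
    {C : Fin M → Fin K → Multiset (EuclideanSpace ℝ (Fin p))}
    (hC : ∀ m, IsKPartition (Dm m) (C m)) : costQ ρ G Dm x ≤ costJ ρ G x C :=
  add_le_add_left (mul_le_mul_of_nonneg_left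
    (Finset.sum_le_sum fun m _ => kmeansF_le_costH (hC m) (x m)) (by positivity)) _

theorem exists_costJ_eq_costQ [NeZero K] (ρ : ℝ) (G : SimpleGraph (Fin M)) [DecidableRel G.Adj]
    (Dm : Fin M → Multiset (EuclideanSpace ℝ (Fin p)))
    (x : Fin M → Fin K → EuclideanSpace ℝ (Fin p)) :
    ∃ C, (∀ m, IsKPartition (Dm m) (C m)) ∧ costJ ρ G x C = costQ ρ G Dm x := by
  choose C hC hcost using fun m => exists_costH_eq_kmeansF (Dm m) (x m)
  exact ⟨C, hC, congrArg (fun s : ℝ => (1 / ρ) * s + _) (Finset.sum_congr rfl fun m _ => hcost m)⟩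

theorem inVoronoi_of_costJ_le_costQ {ρ : ℝ} (hρ : 0 < ρ) {G : SimpleGraph (Fin M)}
    [DecidableRel G.Adj] {Dm : Fin M → Multiset (EuclideanSpace ℝ (Fin p))}
    {x : Fin M → Fin K → EuclideanSpace ℝ (Fin p)}
    {C : Fin M → Fin K → Multiset (EuclideanSpace ℝ (Fin p))}
    (hC : ∀ m, IsKPartition (Dm m) (C m)) (h : costJ ρ G x C ≤ costQ ρ G Dm x) :
    InVoronoi Dm x C := by
  have hle : ∑ m, costH (x m) (C m) ≤ ∑ m, kmeansF K (Dm m) (x m) :=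
    le_of_mul_le_mul_left (le_of_add_le_add_right h) (by positivity)
  have heq := (Finset.sum_eq_sum_iff_of_le fun m _ => kmeansF_le_costH (hC m) (x m)).1
    (hle.antisymm' (Finset.sum_le_sum fun m _ => kmeansF_le_costH (hC m) (x m)))
  exact ⟨hC, fun m _ _ hy k' => norm_sub_le_of_costH_le (hC m) (heq m (Finset.mem_univ m)).ge hy k'⟩

end Helpers

/-- Proposition 2: every global minimizer of `J^ρ` is a generalized
Lloyd's minimum (`J^ρ_g ⊆ J^ρ`), and hence every global minimizer of `Q^ρ` belongs to
`M^ρ` (`M^ρ_g ⊆ M^ρ`). -/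
theorem stmt1 {p K M : ℕ} (hK2 : 2 ≤ K)
    (Dm : Fin M → Multiset (EuclideanSpace ℝ (Fin p)))
    (D : Multiset (EuclideanSpace ℝ (Fin p))) (hD : ∑ m, Dm m = D)
    (hdistinct : HasKDistinct K D)
    (G : SimpleGraph (Fin M)) [DecidableRel G.Adj] (hconn : G.Connected)
    (ρ : ℝ) (hρ : 0 < ρ) :
    (∀ (x : Fin M → Fin K → EuclideanSpace ℝ (Fin p))
        (C : Fin M → Fin K → Multiset (EuclideanSpace ℝ (Fin p))),
      (∀ m, IsKPartition (Dm m) (C m)) →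
      (∀ (x' : Fin M → Fin K → EuclideanSpace ℝ (Fin p))
          (C' : Fin M → Fin K → Multiset (EuclideanSpace ℝ (Fin p))),
        (∀ m, IsKPartition (Dm m) (C' m)) → costJ ρ G x C ≤ costJ ρ G x' C') →
      IsGenLloydMin ρ G Dm x C) ∧
    (∀ x ∈ globQ ρ G Dm K, x ∈ genM ρ G Dm K) := by
  have : NeZero K := ⟨by omega⟩
  have hmain (x : Fin M → Fin K → EuclideanSpace ℝ (Fin p))
      (C : Fin M → Fin K → Multiset (EuclideanSpace ℝ (Fin p)))
      (hC : ∀ m, IsKPartition (Dm m) (C m))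
      (hmin : ∀ (x' : Fin M → Fin K → EuclideanSpace ℝ (Fin p))
          (C' : Fin M → Fin K → Multiset (EuclideanSpace ℝ (Fin p))),
        (∀ m, IsKPartition (Dm m) (C' m)) → costJ ρ G x C ≤ costJ ρ G x' C') :
      IsGenLloydMin ρ G Dm x C := by
    obtain ⟨V, hV, hcost⟩ := exists_costJ_eq_costQ ρ G Dm x
    exact ⟨inVoronoi_of_costJ_le_costQ hρ hC ((hmin x V hV).trans_eq hcost),
      isFixedCenters_of_forall_costJ_le fun x' => hmin x' C hC⟩
  refine ⟨hmain, fun x hx => ?_⟩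
  obtain ⟨V, hV, hcost⟩ := exists_costJ_eq_costQ ρ G Dm x
  exact ⟨V, hmain x V hV fun x' C' hC' => hcost.trans_le ((hx x').trans (costQ_le_costJ hρ G x' hC'))⟩
end
end

section
/- Let the dataset contain at least K distinct points and the communication graph be connected. Let (x̆^ρ)_{ρ∈ℕ} be any sequence such that x̆^ρ is a global minimizer of Q^ρ (x̆^ρ ∈ M^ρ_g) for each ρ ∈ ℕ. Then for each agent m, the distance from x̆_m^ρ = (x̆_m^{ρ,1},…,x̆_m^{ρ,K}) to the set Z_g of global minimizers of the K-means cost F tends to 0 as ρ → ∞; moreover, for every ρ and every m, F(x̆_m^ρ) ≤ F* + 16√M R₀² |D|² / (ρ λ₂(L)), where F* is the global minimum value of F. -/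
open scoped BigOperators

noncomputable section

open Filter Topology

section Spectral

variable {M : ℕ}

theorem lapLam2_le_of_mem_spectrum (G : SimpleGraph (Fin M)) [DecidableRel G.Adj] {μ : ℝ}
    (hμ : μ ∈ spectrum ℝ (G.lapMatrix ℝ)) (h0 : μ ≠ 0) : lapLam2 G ≤ μ := by
  refine csInf_le (Set.Finite.bddBelow ?_) ⟨hμ, h0⟩
  refine Set.Finite.subset ?_ (fun μ h => h.1)
  rw [(G.isHermitian_lapMatrix ℝ).spectrum_real_eq_range_eigenvalues]
  exact Set.finite_range _

theorem lapLam2_pos_or_subsingleton (G : SimpleGraph (Fin M)) [DecidableRel G.Adj]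
    (hconn : G.Connected) : 0 < lapLam2 G ∨ Subsingleton (Fin M) := by
  have hA := G.isHermitian_lapMatrix ℝ
  by_cases hne : {μ : ℝ | μ ∈ spectrum ℝ (G.lapMatrix ℝ) ∧ μ ≠ 0}.Nonempty
  · left
    have hfin : {μ : ℝ | μ ∈ spectrum ℝ (G.lapMatrix ℝ) ∧ μ ≠ 0}.Finite := by
      refine Set.Finite.subset ?_ (fun μ h => h.1)
      rw [hA.spectrum_real_eq_range_eigenvalues]
      exact Set.finite_range _
    obtain ⟨hmem, h0⟩ := hne.csInf_mem hfin
    change lapLam2 G ∈ _ at hmem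
    change lapLam2 G ≠ 0 at h0
    rw [hA.spectrum_real_eq_range_eigenvalues] at hmem
    obtain ⟨i, hi⟩ := hmem
    exact lt_of_le_of_ne (hi ▸ (G.posSemidef_lapMatrix ℝ).eigenvalues_nonneg i) h0.symm
  · right
    have hL : G.lapMatrix ℝ = 0 := by
      rw [← hA.eigenvalues_eq_zero_iff]
      funext i
      by_contra h
      exact hne ⟨hA.eigenvalues i, by
        rw [hA.spectrum_real_eq_range_eigenvalues]; exact ⟨i, rfl⟩, h⟩
    refine ⟨fun i j => ?_⟩
    have h := (G.lapMatrix_mulVec_eq_zero_iff_forall_reachable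
      (x := Pi.single i 1)).1 (by rw [hL, Matrix.zero_mulVec]) i j (hconn.preconnected i j)
    by_contra hij
    simp [Pi.single_eq_of_ne (Ne.symm hij)] at h

/-- The Poincaré inequality for mean-zero functions on a connected graph. -/
theorem lapLam2_mul_sum_sq_le (G : SimpleGraph (Fin M)) [DecidableRel G.Adj]
    (hconn : G.Connected) (v : Fin M → ℝ) (hv : ∑ m, v m = 0) :
    lapLam2 G * ∑ m, v m ^ 2 ≤
      (1 / 2) * ∑ m, ∑ l ∈ G.neighborFinset m, (v m - v l) ^ 2 := by
  have hA := G.isHermitian_lapMatrix ℝ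
  set b := hA.eigenvectorBasis with hb
  have hform : (1 / 2) * ∑ m, ∑ l ∈ G.neighborFinset m, (v m - v l) ^ 2 =
      v ⬝ᵥ (G.lapMatrix ℝ).mulVec v := by
    rw [← Matrix.toLinearMap₂'_apply', G.lapMatrix_toLinearMap₂' ℝ]
    simp only [← Finset.sum_filter, SimpleGraph.neighborFinset_eq_filter]
    ring
  set w : EuclideanSpace ℝ (Fin M) := WithLp.toLp 2 v with hw
  set Lw : EuclideanSpace ℝ (Fin M) := WithLp.toLp 2 ((G.lapMatrix ℝ).mulVec v) with hLw
  have hinner : ∀ i, inner ℝ (b i) Lw = hA.eigenvalues i * inner ℝ (b i) w := by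
    intro i
    have h1 : inner ℝ (b i) Lw = (b i).ofLp ⬝ᵥ (G.lapMatrix ℝ).mulVec v := by
      simp [hLw, PiLp.inner_apply, dotProduct, mul_comm]
    have h2 : inner ℝ (b i) w = (b i).ofLp ⬝ᵥ v := by
      simp [hw, PiLp.inner_apply, dotProduct, mul_comm]
    have ht : (G.lapMatrix ℝ).transpose = G.lapMatrix ℝ := by
      simpa [Matrix.IsHermitian, Matrix.conjTranspose_eq_transpose_of_trivial] using hA
    rw [h1, h2, Matrix.dotProduct_mulVec, ← Matrix.mulVec_transpose, ht,
      hA.mulVec_eigenvectorBasis, smul_dotProduct, smul_eq_mul]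
  have hsq : ∑ m, v m ^ 2 = ∑ i, inner ℝ (b i) w ^ 2 := by
    have h := b.sum_sq_norm_inner_right w
    rw [EuclideanSpace.real_norm_sq_eq] at h
    simpa [hw] using h.symm
  have hquad : v ⬝ᵥ (G.lapMatrix ℝ).mulVec v = ∑ i, hA.eigenvalues i * inner ℝ (b i) w ^ 2 := by
    have h1 : v ⬝ᵥ (G.lapMatrix ℝ).mulVec v = inner ℝ w Lw := by
      simp [hLw, hw, PiLp.inner_apply, dotProduct, mul_comm]
    rw [h1, ← b.sum_inner_mul_inner]
    refine Finset.sum_congr rfl fun i _ => ?_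
    rw [hinner, real_inner_comm]
    ring
  rw [hform, hquad, hsq, Finset.mul_sum]
  refine Finset.sum_le_sum fun i _ => ?_
  by_cases h0 : hA.eigenvalues i = 0
  · have hker : (G.lapMatrix ℝ).mulVec (b i).ofLp = 0 := by
      rw [hA.mulVec_eigenvectorBasis, h0, zero_smul]
    have hconst := G.lapMatrix_mulVec_eq_zero_iff_forall_reachable.1 hker
    have hz : inner ℝ (b i) w = 0 := by
      have h2 : inner ℝ (b i) w = ∑ m, (b i) m * v m := by
        simp [hw, PiLp.inner_apply, mul_comm]
      rw [h2, Finset.sum_congr rfl fun m _ => by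
        rw [hconst m i (hconn.preconnected m i)], ← Finset.mul_sum, hv, mul_zero]
    simp [hz]
  · gcongr
    exact lapLam2_le_of_mem_spectrum G
      (by rw [hA.spectrum_real_eq_range_eigenvalues]; exact ⟨i, rfl⟩) h0

variable {p K : ℕ}

/-- The agreement term of the multi-agent cost. -/
def agreement (G : SimpleGraph (Fin M)) [DecidableRel G.Adj]
    (x : Fin M → Fin K → EuclideanSpace ℝ (Fin p)) : ℝ :=
  (1 / 2) * ∑ m, ∑ l ∈ G.neighborFinset m, ∑ k, ‖x m k - x l k‖ ^ 2

theorem agreement_nonneg (G : SimpleGraph (Fin M)) [DecidableRel G.Adj]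
    (x : Fin M → Fin K → EuclideanSpace ℝ (Fin p)) : 0 ≤ agreement G x := by
  unfold agreement
  positivity

theorem exists_lapLam2_mul_le_agreement (G : SimpleGraph (Fin M)) [DecidableRel G.Adj]
    (hconn : G.Connected) (x : Fin M → Fin K → EuclideanSpace ℝ (Fin p)) :
    ∃ c : Fin K → EuclideanSpace ℝ (Fin p),
      lapLam2 G * ∑ m, ∑ k, ‖x m k - c k‖ ^ 2 ≤ agreement G x := by
  have hM : (M : ℝ) ≠ 0 := by
    obtain ⟨m⟩ := hconn.nonempty
    have := m.pos
    positivity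
  refine ⟨fun k => (M : ℝ)⁻¹ • ∑ m, x m k, ?_⟩
  have key : ∀ (k : Fin K) (i : Fin p),
      lapLam2 G * ∑ m, (x m k i - (M : ℝ)⁻¹ * ∑ l, x l k i) ^ 2 ≤
        (1 / 2) * ∑ m, ∑ l ∈ G.neighborFinset m, (x m k i - x l k i) ^ 2 := by
    intro k i
    have h := lapLam2_mul_sum_sq_le G hconn
      (fun m => x m k i - (M : ℝ)⁻¹ * ∑ l, x l k i)
      (by simp [Finset.sum_sub_distrib, hM])
    simpa using h
  have hsum := Finset.sum_le_sum fun k (_ : k ∈ (Finset.univ : Finset (Fin K))) =>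
    Finset.sum_le_sum fun i (_ : i ∈ (Finset.univ : Finset (Fin p))) => key k i
  simp only [← Finset.mul_sum] at hsum
  have hdev : ∑ m, ∑ k, ‖x m k - (M : ℝ)⁻¹ • ∑ l, x l k‖ ^ 2 =
      ∑ k, ∑ i, ∑ m, (x m k i - (M : ℝ)⁻¹ * ∑ l, x l k i) ^ 2 := by
    rw [Finset.sum_comm]
    refine Finset.sum_congr rfl fun k _ => ?_
    rw [Finset.sum_comm]
    refine Finset.sum_congr rfl fun m _ => ?_
    simp [EuclideanSpace.real_norm_sq_eq]
  have hagr : ∑ m, ∑ l ∈ G.neighborFinset m, ∑ k, ‖x m k - x l k‖ ^ 2 =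
      ∑ k, ∑ i, ∑ m, ∑ l ∈ G.neighborFinset m, (x m k i - x l k i) ^ 2 := by
    simp only [EuclideanSpace.real_norm_sq_eq, PiLp.sub_apply]
    have h : ∀ m, ∑ l ∈ G.neighborFinset m, ∑ k, ∑ i, (x m k i - x l k i) ^ 2 =
        ∑ k, ∑ i, ∑ l ∈ G.neighborFinset m, (x m k i - x l k i) ^ 2 := by
      intro m
      rw [Finset.sum_comm]
      exact Finset.sum_congr rfl fun k _ => Finset.sum_comm
    simp only [h]
    rw [Finset.sum_comm]
    exact Finset.sum_congr rfl fun k _ => Finset.sum_comm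
  rw [agreement, hagr, hdev]
  exact hsum

end Spectral

section Projection

theorem norm_sub_sq_le_add {E : Type*} [SeminormedAddCommGroup E] {y a b : E} {R r : ℝ}
    (hy : ‖y‖ ≤ R) (ha : ‖a‖ ≤ R) (hb : ‖b‖ ≤ R) (hab : ‖a - b‖ ≤ 2 * r) :
    ‖y - a‖ ^ 2 ≤ ‖y - b‖ ^ 2 + 8 * R * r := by
  have h1 := norm_sub_le y a
  have h2 := norm_sub_le y b
  have h3 : ‖y - a‖ - ‖y - b‖ ≤ ‖a - b‖ := by
    simpa [norm_sub_rev b a] using norm_sub_norm_le (y - a) (y - b)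
  have h4 : (‖y - a‖ - ‖y - b‖) * (‖y - a‖ + ‖y - b‖) ≤ (2 * r) * (4 * R) :=
    mul_le_mul (h3.trans hab) (by linarith) (by positivity) ((norm_nonneg _).trans hab)
  linarith

variable {E : Type*} [NormedAddCommGroup E] [InnerProductSpace ℝ E]

/-- The nearest-point map onto a nonempty complete convex set, described by its variational
inequality. -/
theorem exists_projection_inner_le_zero {H : Set E} (hne : H.Nonempty) (hc : IsComplete H)
    (hconv : Convex ℝ H) :
    ∃ P : E → E, (∀ x, P x ∈ H) ∧ ∀ x, ∀ w ∈ H, inner ℝ (x - P x) (w - P x) ≤ 0 := by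
  choose P hP hmin using exists_norm_eq_iInf_of_complete_convex hne hc hconv
  exact ⟨P, hP, fun x => (norm_eq_iInf_iff_real_inner_le_zero hconv (hP x)).1 (hmin x)⟩

variable {H : Set E} {P : E → E}

theorem norm_projection_sub_sq_add_le (hP : ∀ x, P x ∈ H)
    (hin : ∀ x, ∀ w ∈ H, inner ℝ (x - P x) (w - P x) ≤ 0) (x y : E) :
    ‖P x - P y‖ ^ 2 + ‖(x - P x) - (y - P y)‖ ^ 2 ≤ ‖x - y‖ ^ 2 := by
  have h1 := hin x (P y) (hP y)
  have h2 := hin y (P x) (hP x)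
  have h3 : x - y = (P x - P y) + ((x - P x) - (y - P y)) := by abel
  rw [h3, norm_add_sq_real]
  have h4 : inner ℝ (P x - P y) ((x - P x) - (y - P y)) =
      - inner ℝ (x - P x) (P y - P x) - inner ℝ (y - P y) (P x - P y) := by
    rw [inner_sub_right, real_inner_comm, real_inner_comm (y - P y), ← neg_sub (P y) (P x),
      inner_neg_right]
  linarith

theorem norm_sub_projection_sq_add_le
    (hin : ∀ x, ∀ w ∈ H, inner ℝ (x - P x) (w - P x) ≤ 0) (x : E) {y : E} (hy : y ∈ H) :
    ‖y - P x‖ ^ 2 + ‖x - P x‖ ^ 2 ≤ ‖y - x‖ ^ 2 := by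
  have h1 := hin x y hy
  have h3 : y - x = (y - P x) - (x - P x) := by abel
  rw [h3, norm_sub_sq_real (y - P x), real_inner_comm]
  linarith

end Projection

section Centralized

variable {p K : ℕ}

theorem iInf_norm_sub_sq_le (y : EuclideanSpace ℝ (Fin p))
    (x : Fin K → EuclideanSpace ℝ (Fin p)) (k : Fin K) :
    ⨅ k, ‖y - x k‖ ^ 2 ≤ ‖y - x k‖ ^ 2 :=
  ciInf_le (Set.finite_range _).bddBelow k

theorem iInf_norm_sub_sq_nonneg (y : EuclideanSpace ℝ (Fin p))
    (x : Fin K → EuclideanSpace ℝ (Fin p)) : 0 ≤ ⨅ k, ‖y - x k‖ ^ 2 :=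
  Real.iInf_nonneg fun _ => sq_nonneg _

theorem kmeansF_nonneg (D : Multiset (EuclideanSpace ℝ (Fin p)))
    (x : Fin K → EuclideanSpace ℝ (Fin p)) : 0 ≤ kmeansF K D x := by
  refine Multiset.sum_nonneg fun a ha => ?_
  obtain ⟨y, -, rfl⟩ := Multiset.mem_map.1 ha
  exact iInf_norm_sub_sq_nonneg y x

theorem iInf_norm_sub_sq_le_kmeansF {D : Multiset (EuclideanSpace ℝ (Fin p))}
    (x : Fin K → EuclideanSpace ℝ (Fin p)) {y : EuclideanSpace ℝ (Fin p)} (hy : y ∈ D) :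
    ⨅ k, ‖y - x k‖ ^ 2 ≤ kmeansF K D x := by
  refine Multiset.single_le_sum (fun a ha => ?_) _ (Multiset.mem_map_of_mem _ hy)
  obtain ⟨z, -, rfl⟩ := Multiset.mem_map.1 ha
  exact iInf_norm_sub_sq_nonneg z x

theorem kmeansF_sum {ι : Type*} (s : Finset ι) (Dm : ι → Multiset (EuclideanSpace ℝ (Fin p)))
    (x : Fin K → EuclideanSpace ℝ (Fin p)) :
    kmeansF K (∑ m ∈ s, Dm m) x = ∑ m ∈ s, kmeansF K (Dm m) x := by
  unfold kmeansF
  rw [← Multiset.coe_mapAddMonoidHom, map_sum, Multiset.sum_sum]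

theorem Fstar_le (D : Multiset (EuclideanSpace ℝ (Fin p)))
    (x : Fin K → EuclideanSpace ℝ (Fin p)) : Fstar K D ≤ kmeansF K D x :=
  csInf_le ⟨0, by rintro _ ⟨x, rfl⟩; exact kmeansF_nonneg D x⟩ ⟨x, rfl⟩

theorem continuous_kmeansF [NeZero K] (D : Multiset (EuclideanSpace ℝ (Fin p))) :
    Continuous (kmeansF K D) := by
  refine continuous_multiset_sum D fun y _ => ?_
  simp only [← Finset.inf'_univ_eq_ciInf]
  exact Continuous.finset_inf'_apply _ fun k _ => by fun_prop

/-- When the data has at least `K` distinct points, every center of a nearly optimal tuple is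
nearest to some data point. -/
theorem exists_gap_forall_center_used [NeZero K] (hK2 : 2 ≤ K)
    {D : Multiset (EuclideanSpace ℝ (Fin p))} (hdistinct : HasKDistinct K D) :
    ∃ η > 0, ∀ x : Fin K → EuclideanSpace ℝ (Fin p), kmeansF K D x < Fstar K D + η →
      ∀ k, ∃ y ∈ D, ‖y - x k‖ ^ 2 = ⨅ k, ‖y - x k‖ ^ 2 := by
  classical
  obtain ⟨S, hcard, hS⟩ := hdistinct
  have hδ : 0 < (S : Set (EuclideanSpace ℝ (Fin p))).infsep := by
    rw [S.finite_toSet.infsep_pos_iff_nontrivial]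
    exact_mod_cast Finset.one_lt_card_iff_nontrivial.1 (by omega)
  set δ := (S : Set (EuclideanSpace ℝ (Fin p))).infsep
  refine ⟨δ ^ 2 / 4, by positivity, fun x hx k => ?_⟩
  by_contra! hk
  choose j hj using fun y => exists_eq_ciInf_of_finite (f := fun k => ‖y - x k‖ ^ 2)
  have hjk : ∀ y ∈ D, j y ≠ k := fun y hy h => hk y hy (h ▸ hj y)
  obtain ⟨y, hy, z, hz, hyz, hjyz⟩ := Finset.exists_ne_map_eq_of_card_lt_of_maps_to
    (s := S) (t := Finset.univ.erase k) (f := j)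
    (by simp [hcard]; omega)
    (fun y hy => by simpa using hjk y (hS y hy))
  have hfar : ∃ u ∈ S, δ ^ 2 / 4 ≤ ⨅ k, ‖u - x k‖ ^ 2 := by
    by_contra! hlt
    have h1 := hlt y hy
    have h2 := hlt z hz
    rw [← hj] at h1 h2
    rw [← hjyz] at h2
    have h3 : ‖y - x (j y)‖ < δ / 2 := by
      apply lt_of_pow_lt_pow_left₀ 2 (by positivity); nlinarith
    have h4 : ‖z - x (j y)‖ < δ / 2 := by
      apply lt_of_pow_lt_pow_left₀ 2 (by positivity); nlinarith
    have h5 : δ ≤ dist y z := Set.infsep_le_dist_of_mem hy hz hyz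
    have h6 := dist_triangle_right y z (x (j y))
    rw [dist_eq_norm y (x (j y)), dist_eq_norm z (x (j y))] at h6
    linarith
  obtain ⟨u, hu, hfar⟩ := hfar
  obtain ⟨D', rfl⟩ := Multiset.exists_cons_of_mem (hS u hu)
  have hle : kmeansF K (u ::ₘ D') (Function.update x k u) + δ ^ 2 / 4 ≤
      kmeansF K (u ::ₘ D') x := by
    unfold kmeansF
    simp only [Multiset.map_cons, Multiset.sum_cons]
    have h1 : ⨅ i, ‖u - Function.update x k u i‖ ^ 2 ≤ 0 :=
      (iInf_norm_sub_sq_le u _ k).trans (by simp)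
    have h2 := Multiset.sum_map_le_sum_map (s := D')
      (fun y => ⨅ i, ‖y - Function.update x k u i‖ ^ 2) (fun y => ⨅ i, ‖y - x i‖ ^ 2)
      (fun y hy => by
        have h := iInf_norm_sub_sq_le y (Function.update x k u) (j y)
        rw [Function.update_of_ne (hjk y (Multiset.mem_cons_of_mem hy))] at h
        exact h.trans (hj y).le)
    linarith
  have := Fstar_le (u ::ₘ D') (Function.update x k u)
  linarith

/-- Minimizing sequences of the K-means cost approach the set of global minimizers. -/
theorem tendsto_infDist_kmeansZg [NeZero K] (hK2 : 2 ≤ K)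
    {D : Multiset (EuclideanSpace ℝ (Fin p))} (hdistinct : HasKDistinct K D)
    {x : ℕ → Fin K → EuclideanSpace ℝ (Fin p)}
    (hx : Tendsto (fun n => kmeansF K D (x n)) atTop (𝓝 (Fstar K D))) :
    Tendsto (fun n => Metric.infDist (x n) (kmeansZg K D)) atTop (𝓝 0) := by
  obtain ⟨η, hη, hused⟩ := exists_gap_forall_center_used hK2 hdistinct
  have hcont := continuous_kmeansF (K := K) D
  obtain ⟨B, hB⟩ : ∃ B, ∀ y ∈ D, ‖y‖ ≤ B := by
    classical
    obtain ⟨B, hB⟩ := (D.toFinset.image norm).bddAbove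
    exact ⟨B, fun y hy => hB (by simpa using ⟨y, hy, rfl⟩)⟩
  have hcomp : IsCompact {z | kmeansF K D z ≤ Fstar K D + η / 2} := by
    refine Metric.isCompact_of_isClosed_isBounded (isClosed_le hcont continuous_const) ?_
    refine isBounded_iff_forall_norm_le.2
      ⟨max (B + (1 + (Fstar K D + η / 2))) 0, fun z hz => ?_⟩
    rw [pi_norm_le_iff_of_nonneg (le_max_right _ _)]
    intro k
    refine le_max_of_le_left ?_
    simp only [Set.mem_ofPred_eq] at hz
    obtain ⟨y, hy, hyk⟩ := hused z (by linarith) k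
    have h1 := iInf_norm_sub_sq_le_kmeansF z hy
    have h2 : ‖z k‖ ≤ ‖y‖ + ‖y - z k‖ := by
      simpa using norm_sub_le y (y - z k)
    have h3 := hB y hy
    nlinarith [sq_nonneg (‖y - z k‖ - 1)]
  rw [Metric.tendsto_atTop']
  intro ε hε
  suffices h : ∀ᶠ n in atTop, Metric.infDist (x n) (kmeansZg K D) < ε by
    obtain ⟨N, hN⟩ := eventually_atTop.1 h
    refine ⟨N, fun n hn => ?_⟩
    rw [Real.dist_0_eq_abs, abs_of_nonneg Metric.infDist_nonneg]
    exact hN n hn.le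
  have hfar : IsCompact ({z | kmeansF K D z ≤ Fstar K D + η / 2} ∩
      {z | ε ≤ Metric.infDist z (kmeansZg K D)}) :=
    hcomp.inter_right (isClosed_le continuous_const (Metric.continuous_infDist_pt _))
  have hnear : ∀ᶠ n in atTop, kmeansF K D (x n) < Fstar K D + η / 2 :=
    hx.eventually_lt_const (by linarith)
  by_cases hne : ({z | kmeansF K D z ≤ Fstar K D + η / 2} ∩
      {z | ε ≤ Metric.infDist z (kmeansZg K D)}).Nonempty
  · obtain ⟨z, hz, hzmin⟩ := hfar.exists_isMinOn hne hcont.continuousOn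
    have hlt : Fstar K D < kmeansF K D z := by
      refine lt_of_le_of_ne (Fstar_le D z) fun h => ?_
      have hzZ : z ∈ kmeansZg K D := fun z' => h ▸ Fstar_le D z'
      have h2 := hz.2
      rw [Set.mem_ofPred_eq, Metric.infDist_zero_of_mem hzZ] at h2
      linarith
    filter_upwards [hnear, hx.eventually_lt_const hlt] with n h1 h2
    by_contra! h3
    exact absurd (hzmin ⟨h1.le, h3⟩) (not_le.2 h2)
  · filter_upwards [hnear] with n h1
    by_contra! h3
    exact hne ⟨_, h1.le, h3⟩

theorem norm_le_R0 {D : Multiset (EuclideanSpace ℝ (Fin p))} {v : EuclideanSpace ℝ (Fin p)}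
    (hv : v ∈ convexHull ℝ {y | y ∈ D}) : ‖v‖ ≤ R0 D := by
  classical
  have hfin : {y | y ∈ D}.Finite := by
    simp [← Multiset.mem_toFinset]
  exact le_csSup ((hfin.isCompact_convexHull ℝ).image continuous_norm).bddAbove ⟨v, hv, rfl⟩

end Centralized

section Distributed

variable {p K M : ℕ}

theorem costQ_eq (ρ : ℝ) (G : SimpleGraph (Fin M)) [DecidableRel G.Adj]
    (Dm : Fin M → Multiset (EuclideanSpace ℝ (Fin p)))
    (x : Fin M → Fin K → EuclideanSpace ℝ (Fin p)) :
    costQ ρ G Dm x = (1 / ρ) * ∑ m, kmeansF K (Dm m) (x m) + agreement G x :=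
  rfl

theorem eq_of_agreement_le_zero {G : SimpleGraph (Fin M)} [DecidableRel G.Adj]
    (hconn : G.Connected) {x : Fin M → Fin K → EuclideanSpace ℝ (Fin p)}
    (h : agreement G x ≤ 0) (m l : Fin M) (k : Fin K) : x m k = x l k := by
  have h0 : ∑ m, ∑ l ∈ G.neighborFinset m, ∑ k, ‖x m k - x l k‖ ^ 2 = 0 :=
    le_antisymm (by unfold agreement at h; linarith) (by positivity)
  have hadj : ∀ m l, G.Adj m l → x m k = x l k := by
    intro m l hml
    rw [Finset.sum_eq_zero_iff_of_nonneg fun _ _ => by positivity] at h0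
    have h1 := h0 m (Finset.mem_univ m)
    rw [Finset.sum_eq_zero_iff_of_nonneg fun _ _ => by positivity] at h1
    have h2 := h1 l (by simpa using hml)
    rw [Finset.sum_eq_zero_iff_of_nonneg fun _ _ => by positivity] at h2
    have h3 := h2 k (Finset.mem_univ k)
    exact sub_eq_zero.1 (norm_eq_zero.1 (pow_eq_zero_iff two_ne_zero |>.1 h3))
  obtain ⟨w⟩ := hconn.preconnected m l
  induction w with
  | nil => rfl
  | cons h _ ih => exact (hadj _ _ h).trans ih

/-- At a global minimizer, if some agent has a data point nearest to its `k`-th center, then the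
`k`-th centers of all agents lie in the convex hull of the data. -/
theorem mem_convexHull_of_mem_globQ {ρ : ℝ} (hρ : 0 < ρ) {G : SimpleGraph (Fin M)}
    [DecidableRel G.Adj] (hconn : G.Connected)
    {Dm : Fin M → Multiset (EuclideanSpace ℝ (Fin p))}
    {D : Multiset (EuclideanSpace ℝ (Fin p))} (hD : ∑ m, Dm m = D) [NeZero K]
    {x : Fin M → Fin K → EuclideanSpace ℝ (Fin p)} (hx : x ∈ globQ ρ G Dm K)
    {l : Fin M} {y : EuclideanSpace ℝ (Fin p)} (hy : y ∈ Dm l) {k : Fin K}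
    (hk : ‖y - x l k‖ ^ 2 = ⨅ k, ‖y - x l k‖ ^ 2) (m : Fin M) :
    x m k ∈ convexHull ℝ {y | y ∈ D} := by
  classical
  have hmemD : ∀ m, ∀ z ∈ Dm m, z ∈ convexHull ℝ {y | y ∈ D} := fun m z hz =>
    subset_convexHull ℝ _ (by
      simp only [Set.mem_ofPred_eq, ← hD, Multiset.mem_sum]
      exact ⟨m, Finset.mem_univ m, hz⟩)
  have hfin : {y | y ∈ D}.Finite := by
    simp [← Multiset.mem_toFinset]
  obtain ⟨P, hP, hin⟩ := exists_projection_inner_le_zero ⟨y, hmemD l y hy⟩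
    (hfin.isCompact_convexHull ℝ).isComplete (convex_convexHull ℝ {y | y ∈ D})
  set x' : Fin M → Fin K → EuclideanSpace ℝ (Fin p) := fun m k => P (x m k) with hx'
  set d : Fin M → Fin K → EuclideanSpace ℝ (Fin p) := fun m k => x m k - P (x m k) with hd
  have hpoint : ∀ m, ∀ z ∈ Dm m, ⨅ k, ‖z - x' m k‖ ^ 2 ≤ ⨅ k, ‖z - x m k‖ ^ 2 := by
    intro m z hz
    refine le_ciInf fun k => (iInf_norm_sub_sq_le z (x' m) k).trans ?_
    have := norm_sub_projection_sq_add_le hin (x m k) (hmemD m z hz)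
    have := sq_nonneg ‖x m k - P (x m k)‖
    simp only [hx']
    linarith
  have hF : ∀ m, kmeansF K (Dm m) (x' m) ≤ kmeansF K (Dm m) (x m) := fun m =>
    Multiset.sum_map_le_sum_map _ _ (hpoint m)
  have hT : ∑ m, kmeansF K (Dm m) (x' m) ≤ ∑ m, kmeansF K (Dm m) (x m) :=
    Finset.sum_le_sum fun m _ => hF m
  have hA : agreement G x' + agreement G d ≤ agreement G x := by
    unfold agreement
    rw [← mul_add]
    simp only [← Finset.sum_add_distrib]
    gcongr with m _ l _ k _
    exact norm_projection_sub_sq_add_le hP hin _ _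
  have hQ := hx x'
  rw [costQ_eq, costQ_eq] at hQ
  have hTρ : (1 / ρ) * ∑ m, kmeansF K (Dm m) (x' m) ≤
      (1 / ρ) * ∑ m, kmeansF K (Dm m) (x m) := by gcongr
  have hd0 := eq_of_agreement_le_zero hconn (x := d) (by linarith)
  have hTeq : ∑ m, kmeansF K (Dm m) (x m) ≤ ∑ m, kmeansF K (Dm m) (x' m) := by
    have := agreement_nonneg G d
    refine le_of_mul_le_mul_left (a := 1 / ρ) (by linarith) (by positivity)
  have hdl : d l k = 0 := by
    by_contra hne
    have hlt : kmeansF K (Dm l) (x' l) < kmeansF K (Dm l) (x l) := by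
      refine Multiset.sum_lt_sum (hpoint l) ⟨y, hy, ?_⟩
      refine (iInf_norm_sub_sq_le y (x' l) k).trans_lt ?_
      have h1 := norm_sub_projection_sq_add_le hin (x l k) (hmemD l y hy)
      have h2 : 0 < ‖x l k - P (x l k)‖ ^ 2 := by
        have := norm_pos_iff.2 hne
        positivity
      simp only [hx']
      linarith
    have := Finset.sum_lt_sum (fun m _ => hF m) ⟨l, Finset.mem_univ l, hlt⟩
    linarith
  have hdm : x m k - P (x m k) = 0 := (hd0 m l k).trans hdl
  rw [sub_eq_zero.1 hdm]
  exact hP _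

/-- The suboptimality of every agent's centers at a global minimizer of `Q^ρ`. -/
theorem kmeansF_le_of_mem_globQ [NeZero K] {ρ : ℝ} (hρ : 0 < ρ) {G : SimpleGraph (Fin M)}
    [DecidableRel G.Adj] (hconn : G.Connected)
    {Dm : Fin M → Multiset (EuclideanSpace ℝ (Fin p))}
    {D : Multiset (EuclideanSpace ℝ (Fin p))} (hD : ∑ m, Dm m = D)
    {x : Fin M → Fin K → EuclideanSpace ℝ (Fin p)} (hx : x ∈ globQ ρ G Dm K) (m : Fin M) :
    kmeansF K D (x m) ≤ Fstar K D +
      16 * Real.sqrt M * R0 D ^ 2 * (Multiset.card D : ℝ) ^ 2 / (ρ * lapLam2 G) := by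
  have hopt : ∑ l, kmeansF K (Dm l) (x l) + ρ * agreement G x ≤ Fstar K D := by
    refine le_csInf (Set.range_nonempty _) ?_
    rintro _ ⟨z, rfl⟩
    have h := hx fun _ => z
    rw [costQ_eq, costQ_eq, ← kmeansF_sum, hD] at h
    have h0 : agreement G (fun _ : Fin M => z) = 0 := by simp [agreement]
    rw [h0] at h
    have h' := mul_le_mul_of_nonneg_left h hρ.le
    field_simp at h'
    linarith
  rcases lapLam2_pos_or_subsingleton G hconn with hlam | hsub
  · obtain ⟨c, hc⟩ := exists_lapLam2_mul_le_agreement G hconn x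
    obtain ⟨S, hS⟩ : ∃ S, S = ∑ m, ∑ k, ‖x m k - c k‖ ^ 2 := ⟨_, rfl⟩
    have hS0 : 0 ≤ S := by rw [hS]; positivity
    rw [← hS] at hc
    have hclose : ∀ m k, ‖x m k - c k‖ ≤ √S := by
      intro m k
      refine Real.le_sqrt_of_sq_le ?_
      rw [hS]
      refine (Finset.single_le_sum (f := fun k => ‖x m k - c k‖ ^ 2)
        (fun _ _ => by positivity) (Finset.mem_univ k)).trans ?_
      exact Finset.single_le_sum (f := fun m => ∑ k, ‖x m k - c k‖ ^ 2)
        (fun _ _ => by positivity) (Finset.mem_univ m)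
    have hpoint : ∀ l, ∀ y ∈ Dm l,
        ⨅ k, ‖y - x m k‖ ^ 2 ≤ (⨅ k, ‖y - x l k‖ ^ 2) + 8 * R0 D * √S := by
      intro l y hy
      obtain ⟨k, hk⟩ := exists_eq_ciInf_of_finite (f := fun k => ‖y - x l k‖ ^ 2)
      have hhull := mem_convexHull_of_mem_globQ hρ hconn hD hx hy hk
      have hyD : ‖y‖ ≤ R0 D := norm_le_R0 (subset_convexHull ℝ _ (by
        simp only [Set.mem_ofPred_eq, ← hD, Multiset.mem_sum]
        exact ⟨l, Finset.mem_univ l, hy⟩))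
      refine (iInf_norm_sub_sq_le y (x m) k).trans ?_
      rw [← hk]
      refine norm_sub_sq_le_add hyD (norm_le_R0 (hhull m)) (norm_le_R0 (hhull l)) ?_
      have h := norm_sub_le (x m k - c k) (x l k - c k)
      rw [sub_sub_sub_cancel_right] at h
      linarith [hclose l k, hclose m k]
    have hsum : kmeansF K D (x m) ≤
        ∑ l, kmeansF K (Dm l) (x l) + (Multiset.card D : ℝ) * (8 * R0 D * √S) := by
      rw [← hD, kmeansF_sum, Multiset.card_sum, hD, Nat.cast_sum, Finset.sum_mul,
        ← Finset.sum_add_distrib]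
      refine Finset.sum_le_sum fun l _ => ?_
      have h := Multiset.sum_map_le_sum_map _ _ (hpoint l)
      rw [Multiset.sum_map_add, Multiset.map_const', Multiset.sum_replicate, nsmul_eq_mul] at h
      exact h
    have hsq : √S ^ 2 = S := Real.sq_sqrt hS0
    have hquad : (Multiset.card D : ℝ) * (8 * R0 D * √S) - ρ * (lapLam2 G * S) ≤
        16 * R0 D ^ 2 * (Multiset.card D : ℝ) ^ 2 / (ρ * lapLam2 G) := by
      have hρS : ρ * (lapLam2 G * S) = ρ * (lapLam2 G * √S ^ 2) := by rw [hsq]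
      rw [le_div_iff₀ (by positivity), hρS]
      linarith [sq_nonneg (4 * R0 D * (Multiset.card D : ℝ) - ρ * lapLam2 G * √S)]
    have hM : (1 : ℝ) ≤ √M := by
      rw [Real.one_le_sqrt]
      exact_mod_cast m.pos
    have hfinal : 16 * R0 D ^ 2 * (Multiset.card D : ℝ) ^ 2 / (ρ * lapLam2 G) ≤
        16 * √M * R0 D ^ 2 * (Multiset.card D : ℝ) ^ 2 / (ρ * lapLam2 G) := by
      refine div_le_div_of_nonneg_right ?_ (by positivity)
      have : 0 ≤ 16 * R0 D ^ 2 * (Multiset.card D : ℝ) ^ 2 := by positivity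
      nlinarith
    have hρA := mul_le_mul_of_nonneg_left hc hρ.le
    linarith
  · have hF : kmeansF K D (x m) = ∑ l, kmeansF K (Dm l) (x l) := by
      rw [← hD, kmeansF_sum]
      exact Finset.sum_congr rfl fun l _ => by rw [Subsingleton.elim m l]
    have hlam : 0 ≤ lapLam2 G := by
      refine Real.sInf_nonneg ?_
      rintro μ ⟨hμ, -⟩
      rw [(G.isHermitian_lapMatrix ℝ).spectrum_real_eq_range_eigenvalues] at hμ
      obtain ⟨i, rfl⟩ := hμ
      exact (G.posSemidef_lapMatrix ℝ).eigenvalues_nonneg i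
    have h1 : 0 ≤ 16 * √M * R0 D ^ 2 * (Multiset.card D : ℝ) ^ 2 / (ρ * lapLam2 G) := by
      positivity
    have h2 := mul_nonneg hρ.le (agreement_nonneg G x)
    linarith

end Distributed

/-- Theorem 2: if `x̆^ρ ∈ M^ρ_g` for each `ρ ∈ ℕ₊`, then for each
agent `m`, `d(x̆_m^ρ, Z_g) → 0` as `ρ → ∞`; moreover
`F(x̆_m^ρ) ≤ F* + 16√M R₀² |D|² / (ρ λ₂(L))`. -/
theorem stmt4 {p K M : ℕ} (hK2 : 2 ≤ K)
    (Dm : Fin M → Multiset (EuclideanSpace ℝ (Fin p)))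
    (D : Multiset (EuclideanSpace ℝ (Fin p))) (hD : ∑ m, Dm m = D)
    (hdistinct : HasKDistinct K D)
    (G : SimpleGraph (Fin M)) [DecidableRel G.Adj] (hconn : G.Connected)
    (xs : ℕ → Fin M → Fin K → EuclideanSpace ℝ (Fin p))
    (hxs : ∀ n : ℕ, xs n ∈ globQ ((n : ℝ) + 1) G Dm K) :
    (∀ m, Filter.Tendsto (fun n => Metric.infDist (xs n m) (kmeansZg K D))
        Filter.atTop (nhds 0)) ∧
      ∀ (n : ℕ) (m : Fin M),
        kmeansF K D (xs n m) ≤ Fstar K D +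
          16 * Real.sqrt M * R0 D ^ 2 * (Multiset.card D : ℝ) ^ 2 /
            (((n : ℝ) + 1) * lapLam2 G) := by
  have : NeZero K := ⟨by omega⟩
  have hbound := fun (n : ℕ) (m : Fin M) =>
    kmeansF_le_of_mem_globQ (by positivity : (0 : ℝ) < (n : ℝ) + 1) hconn hD (hxs n) m
  refine ⟨fun m => tendsto_infDist_kmeansZg hK2 hdistinct ?_, hbound⟩
  refine tendsto_of_tendsto_of_tendsto_of_le_of_le tendsto_const_nhds ?_
    (fun n => Fstar_le D (xs n m)) (fun n => hbound n m)
  have hlim := (tendsto_one_div_add_atTop_nhds_zero_nat (𝕜 := ℝ)).const_mul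
    (16 * Real.sqrt M * R0 D ^ 2 * (Multiset.card D : ℝ) ^ 2 / lapLam2 G)
  have hadd := hlim.const_add (Fstar K D)
  rw [mul_zero, add_zero] at hadd
  refine hadd.congr fun n => ?_
  rw [div_mul_div_comm, mul_one, mul_comm (lapLam2 G)]
end
end
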